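/- If every 2-maximal subgroup of a finite group G is S-quasinormal in G, then G is nearly nilpotent. -/

import Mathlib

open Subgroup Pointwise

variable {G : Type*} [Group G]

/-- A subgroup `M` of `G` is modular if it is a modular element of the lattice of
subgroups of `G`. -/
def IsModularSubgroup (M : Subgroup G) : Prop :=
  (∀ X Z : Subgroup G, X ≤ Z → X ⊔ (M ⊓ Z) = (X ⊔ M) ⊓ Z) ∧
  (∀ Y Z : Subgroup G, M ≤ Z → M ⊔ (Y ⊓ Z) = (M ⊔ Y) ⊓ Z)

/-- A subgroup `H` of `G` is S-quasinormal if `HP = PH` for every Sylow subgroup `P` of `G`. -/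
def IsSQuasinormal (H : Subgroup G) : Prop :=
  ∀ (p : ℕ), p.Prime → ∀ P : Sylow p G,
    (H : Set G) * ((P : Subgroup G) : Set G) = ((P : Subgroup G) : Set G) * (H : Set G)

/-- `H` is a maximal subgroup of `K` (both being subgroups of the ambient group `G`). -/
def IsMaximalIn (K H : Subgroup G) : Prop :=
  H < K ∧ ∀ L : Subgroup G, H < L → L ≤ K → L = K

/-- `H` is an `n`-maximal subgroup of `G`: there is a chain
`H = M_n < … < M_1 < M_0 = G` with `M_i` maximal in `M_{i-1}` for all `i`. -/
def IsNMaximal (n : ℕ) (H : Subgroup G) : Prop :=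
  ∃ M : Fin (n + 1) → Subgroup G,
    M 0 = ⊤ ∧ M (Fin.last n) = H ∧
    ∀ i : Fin n, IsMaximalIn (M i.castSucc) (M i.succ)

/-- A group is supersoluble if it has a normal series with cyclic factors. -/
def IsSupersoluble (G : Type*) [Group G] : Prop :=
  ∃ (n : ℕ) (s : Fin (n + 1) → Subgroup G) (_hnorm : ∀ i, (s i).Normal),
    s 0 = ⊥ ∧ s (Fin.last n) = ⊤ ∧
    ∀ i : Fin n, s i.castSucc ≤ s i.succ ∧
      haveI := _hnorm i.castSucc
      IsCyclic ↥((s i.succ).map (QuotientGroup.mk' (s i.castSucc)))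

/-- `H/K` is a chief factor of `G`: both are normal in `G`, `K < H`, and there is no
normal subgroup of `G` strictly between `K` and `H` (i.e. `H/K` is a minimal normal
subgroup of `G/K`). -/
def IsChiefFactor (H K : Subgroup G) : Prop :=
  K.Normal ∧ H.Normal ∧ K < H ∧
    ∀ N : Subgroup G, N.Normal → K < N → N ≤ H → N = H

/-- The centralizer `C_G(H/K)` of a factor `H/K`: the preimage in `G` of the
centralizer of `HK/K` in `G/K`. -/
def chiefCentralizer (H K : Subgroup G) (hK : K.Normal) : Subgroup G :=
  haveI := hK
  Subgroup.comap (QuotientGroup.mk' K)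
    (Subgroup.centralizer ((H.map (QuotientGroup.mk' K) : Subgroup (G ⧸ K)) : Set (G ⧸ K)))

/-- The factor `H/K` is non-Frattini, i.e. `HK/K ≰ Φ(G/K)`. -/
def IsNonFrattini (H K : Subgroup G) (hK : K.Normal) : Prop :=
  haveI := hK
  ¬ H.map (QuotientGroup.mk' K) ≤ frattini (G ⧸ K)

/-- A group is strongly supersoluble if it is supersoluble and the automorphism group
`G/C_G(H/K)` induced by `G` on any chief factor `H/K` has square-free order. -/
def IsStronglySupersoluble (G : Type*) [Group G] : Prop :=
  IsSupersoluble G ∧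
    ∀ H K : Subgroup G, ∀ hc : IsChiefFactor H K,
      Squarefree (chiefCentralizer H K hc.1).index

/-- A group is nearly nilpotent if it is supersoluble and the automorphism group
`G/C_G(H/K)` induced by `G` on any non-Frattini chief factor `H/K` has order dividing
a prime. -/
def IsNearlyNilpotent (G : Type*) [Group G] : Prop :=
  IsSupersoluble G ∧
    ∀ H K : Subgroup G, ∀ hc : IsChiefFactor H K, IsNonFrattini H K hc.1 →
      ∃ p : ℕ, p.Prime ∧ (chiefCentralizer H K hc.1).index ∣ p

/-- The strongly supersoluble residual `G^{U_s}`: the intersection of all normal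
subgroups `N` of `G` with `G/N` strongly supersoluble. -/
def ssResidual (G : Type*) [Group G] : Subgroup G :=
  sInf {N : Subgroup G | ∃ _hN : N.Normal,
    haveI := _hN
    IsStronglySupersoluble (G ⧸ N)}

/-- The subgroup `O^p(G)`, generated by all elements of prime power order for primes other
than `p`. -/
def pResidual (p : ℕ) (G : Type*) [Group G] : Subgroup G :=
  Subgroup.closure {x | ∃ q : ℕ, q.Prime ∧ q ≠ p ∧ ∃ k : ℕ, x ^ q ^ k = 1}

/-- Every maximal subgroup of every maximal subgroup of `G` is S-quasinormal in `G`. -/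
def TwoMaximalSQuasinormal (G : Type*) [Group G] : Prop :=
  ∀ M : Subgroup G, IsCoatom M → ∀ A : Subgroup M, IsCoatom A → IsSQuasinormal (A.map M.subtype)

theorem exists_sylow_mem {q k : ℕ} {x : G} (hx : x ^ q ^ k = 1) : ∃ Q : Sylow q G, x ∈ Q := by
  have hp : IsPGroup q (Subgroup.zpowers x) := by
    rintro ⟨_, n, rfl⟩
    refine ⟨k, Subtype.ext ?_⟩
    change (x ^ n) ^ q ^ k = 1
    rw [← zpow_natCast, ← zpow_mul, mul_comm, zpow_mul, zpow_natCast, hx, one_zpow]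
  obtain ⟨Q, hQ⟩ := hp.exists_le_sylow
  exact ⟨Q, hQ (Subgroup.mem_zpowers x)⟩

theorem sylow_le_pResidual {p q : ℕ} (hq : q.Prime) (hqp : q ≠ p) (Q : Sylow q G) :
    (Q : Subgroup G) ≤ pResidual p G := by
  intro x hx
  obtain ⟨k, hk⟩ := Q.isPGroup' ⟨x, hx⟩
  exact Subgroup.subset_closure ⟨q, hq, hqp, k, congrArg Subtype.val hk⟩

instance pResidual_normal (p : ℕ) : (pResidual p G).Normal := by
  refine ⟨fun x hx g => ?_⟩
  induction hx using Subgroup.closure_induction with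
  | mem x hx =>
    obtain ⟨q, hq, hqp, k, hk⟩ := hx
    exact Subgroup.subset_closure ⟨q, hq, hqp, k, by rw [conj_pow, hk]; simp⟩
  | one => simp
  | mul x y _ _ hx hy => simpa [conj_mul] using mul_mem hx hy
  | inv x _ hx => exact conj_inv (a := x) ▸ inv_mem hx

theorem isPGroup_quotient_pResidual [Finite G] {p : ℕ} :
    IsPGroup p (G ⧸ pResidual p G) := by
  refine IsPGroup.of_card (n := (pResidual p G).index.primeFactorsList.length)
    (Nat.eq_prime_pow_of_unique_prime_dvd (pResidual p G).index_ne_zero_of_finite ?_)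
  intro q hq hdvd
  by_contra hqp
  have := Fact.mk hq
  let Q : Sylow q G := default
  exact Q.not_dvd_index (hdvd.trans (Subgroup.index_dvd_of_le (sylow_le_pResidual hq hqp Q)))

theorem mem_sup_of_mul_comm {A P : Subgroup G} (h : (A : Set G) * P = P * A) {x : G}
    (hx : x ∈ A ⊔ P) : ∃ p ∈ P, ∃ a ∈ A, p * a = x := by
  rw [Subgroup.sup_eq_closure_mul] at hx
  induction hx using Subgroup.closure_induction with
  | mem x hx => rwa [h] at hx
  | one => exact ⟨1, one_mem _, 1, one_mem _, mul_one 1⟩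
  | mul x y _ _ hx hy =>
    obtain ⟨p, hp, a, ha, rfl⟩ := hx
    obtain ⟨p', hp', a', ha', rfl⟩ := hy
    obtain ⟨q, hq, b, hb, hqb⟩ := h.subset (Set.mul_mem_mul ha hp')
    refine ⟨p * q, mul_mem hp hq, b * a', mul_mem hb ha', ?_⟩
    simp only at hqb
    rw [mul_assoc, ← mul_assoc q, hqb]
    group
  | inv x _ hx =>
    obtain ⟨p, hp, a, ha, rfl⟩ := hx
    rw [mul_inv_rev]
    exact h.subset (Set.mul_mem_mul (inv_mem ha) (inv_mem hp))

theorem relIndex_sup_of_mul_comm {A P : Subgroup G} (h : (A : Set G) * P = P * A) :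
    A.relIndex (A ⊔ P) = A.relIndex P := by
  have hle : P ≤ A ⊔ P := le_sup_right
  have hbij : Function.Bijective (Subgroup.quotientSubgroupOfEmbeddingOfLE A hle) := by
    refine ⟨(Subgroup.quotientSubgroupOfEmbeddingOfLE A hle).injective, fun y => ?_⟩
    obtain ⟨⟨y, hy⟩, rfl⟩ := QuotientGroup.mk_surjective y
    obtain ⟨p, hp, a, ha, rfl⟩ := mem_sup_of_mul_comm h hy
    refine ⟨QuotientGroup.mk ⟨p, hp⟩, ?_⟩
    rw [Subgroup.quotientSubgroupOfEmbeddingOfLE_apply_mk, QuotientGroup.eq]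
    simpa [Subgroup.mem_subgroupOf] using ha
  exact (Nat.card_eq_of_bijective _ hbij).symm

theorem IsSQuasinormal.relIndex_sup_sylow [Finite G] {A : Subgroup G} (hA : IsSQuasinormal A)
    {p : ℕ} (hp : p.Prime) (P : Sylow p G) : ∃ n, A.relIndex (A ⊔ P) = p ^ n := by
  have := Fact.mk hp
  obtain ⟨n, hn⟩ := P.isPGroup'.exists_card_eq
  have hdvd := Subgroup.relIndex_dvd_card A P
  rw [hn, ← relIndex_sup_of_mul_comm (hA p hp P)] at hdvd
  obtain ⟨m, -, hm⟩ := (Nat.dvd_prime_pow hp).mp hdvd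
  exact ⟨m, hm⟩

theorem IsSQuasinormal.pResidual_le [Finite G] {A : Subgroup G} (hA : IsSQuasinormal A)
    {p : ℕ} (hp : p.Prime) (P : Sylow p G) (hP : A ⊔ P = ⊤) : pResidual p G ≤ A := by
  obtain ⟨n, hn⟩ := hA.relIndex_sup_sylow hp P
  rw [hP, Subgroup.relIndex_top_right] at hn
  rw [pResidual, Subgroup.closure_le]
  rintro x ⟨q, hq, hqp, k, hk⟩
  obtain ⟨Q, hQ⟩ := exists_sylow_mem hk
  obtain ⟨m, hm⟩ := hA.relIndex_sup_sylow hq Q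
  have hdvd := Subgroup.relIndex_dvd_index_of_le (le_sup_left : A ≤ A ⊔ Q)
  have hone : A.relIndex (A ⊔ Q) = 1 := by
    refine Nat.Coprime.eq_one_of_dvd ?_ hdvd
    rw [hm, hn]
    exact Nat.coprime_pow_primes m n hq hp hqp
  exact Subgroup.relIndex_eq_one.mp hone ((le_sup_right : (Q : Subgroup G) ≤ A ⊔ Q) hQ)

theorem exists_sylow_not_le [Finite G] {A : Subgroup G} (hA : A ≠ ⊤) :
    ∃ p : ℕ, p.Prime ∧ ∃ P : Sylow p G, ¬ (P : Subgroup G) ≤ A := by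
  by_contra! hall
  obtain ⟨p, hp, hdvd⟩ := Nat.exists_prime_and_dvd (mt Subgroup.index_eq_one.mp hA)
  have := Fact.mk hp
  let P : Sylow p G := default
  exact P.not_dvd_index (hdvd.trans (Subgroup.index_dvd_of_le (hall p hp P)))

theorem normal_of_isCoatom [Finite G] [Group.IsNilpotent G] {A : Subgroup G} (hA : IsCoatom A) :
    A.Normal :=
  (Group.isNilpotent_of_finite_tfae (G := G)).out 0 2 rfl rfl |>.mp ‹_› A hA

theorem isCoatom_map_mk {N A : Subgroup G} [N.Normal] (hA : IsCoatom A) (hN : N ≤ A) :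
    IsCoatom (A.map (QuotientGroup.mk' N)) := by
  have hs := QuotientGroup.mk'_surjective N
  have hc : (A.map (QuotientGroup.mk' N)).comap (QuotientGroup.mk' N) = A :=
    Subgroup.comap_map_eq_self (by simpa using hN)
  refine ⟨fun htop => hA.1 (by rw [← hc, htop, Subgroup.comap_top]), fun K hK => ?_⟩
  rw [← Subgroup.comap_lt_comap_of_surjective hs, hc] at hK
  exact Subgroup.comap_injective hs (by rw [hA.2 _ hK, Subgroup.comap_top])

theorem IsSQuasinormal.normal_of_isCoatom [Finite G] {A : Subgroup G} (hA : IsSQuasinormal A)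
    (hmax : IsCoatom A) : A.Normal := by
  obtain ⟨p, hp, P, hP⟩ := exists_sylow_not_le hmax.1
  have := Fact.mk hp
  have hle : pResidual p G ≤ A :=
    hA.pResidual_le hp P (hmax.2 _ (left_lt_sup.mpr hP))
  have : Group.IsNilpotent (G ⧸ pResidual p G) := isPGroup_quotient_pResidual.isNilpotent
  have hn := _root_.normal_of_isCoatom (isCoatom_map_mk hmax hle)
  have := hn.comap (QuotientGroup.mk' (pResidual p G))
  rwa [Subgroup.comap_map_eq_self (by simpa using hle)] at this

theorem IsSQuasinormal.of_map_subtype [Finite G] {M : Subgroup G} {A : Subgroup M}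
    (hA : IsSQuasinormal (A.map M.subtype)) : IsSQuasinormal A := by
  intro p hp Q
  have := Fact.mk hp
  obtain ⟨P, hP⟩ := Q.exists_comap_subtype_eq
  have hmem (x : M) : x ∈ Q ↔ (x : G) ∈ P := by
    change x ∈ (Q : Subgroup M) ↔ _
    rw [← hP]
    rfl
  have h := hA p hp P
  ext x
  constructor
  · rintro ⟨a, ha, b, hb, rfl⟩
    obtain ⟨c, hc, _, ⟨d, hd, rfl⟩, hcd⟩ := h.subset
      (Set.mul_mem_mul (Subgroup.mem_map_of_mem M.subtype ha) ((hmem b).mp hb))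
    refine ⟨a * b * d⁻¹, (hmem _).mpr ?_, d, hd, by simp⟩
    have : ((a * b * d⁻¹ : M) : G) = c := by simpa [mul_inv_eq_iff_eq_mul] using hcd.symm
    rwa [this]
  · rintro ⟨b, hb, a, ha, rfl⟩
    obtain ⟨_, ⟨d, hd, rfl⟩, c, hc, hcd⟩ := h.symm.subset
      (Set.mul_mem_mul ((hmem b).mp hb) (Subgroup.mem_map_of_mem M.subtype ha))
    refine ⟨d, hd, d⁻¹ * (b * a), (hmem _).mpr ?_, by simp⟩
    have : ((d⁻¹ * (b * a) : M) : G) = c := by simpa [inv_mul_eq_iff_eq_mul] using hcd.symm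
    rwa [this]

theorem IsSQuasinormal.map [Finite G] {G' : Type*} [Group G'] {f : G →* G'}
    (hf : Function.Surjective f) {A : Subgroup G} (hA : IsSQuasinormal A) :
    IsSQuasinormal (A.map f) := by
  intro p hp Q
  have := Fact.mk hp
  obtain ⟨P, rfl⟩ := Sylow.mapSurjective_surjective hf p Q
  simp only [Sylow.coe_mapSurjective, Subgroup.coe_map]
  rw [← Set.image_mul, hA p hp P, Set.image_mul]

theorem TwoMaximalSQuasinormal.isNilpotent_of_isCoatom [Finite G]
    (h : TwoMaximalSQuasinormal G) {M : Subgroup G} (hM : IsCoatom M) : Group.IsNilpotent M :=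
  (Group.isNilpotent_of_finite_tfae (G := M)).out 0 2 rfl rfl |>.mpr fun A hA =>
    (h M hM A hA).of_map_subtype.normal_of_isCoatom hA

theorem isNilpotent_of_le {H K : Subgroup G} (h : H ≤ K) [Group.IsNilpotent K] :
    Group.IsNilpotent H :=
  Group.nilpotent_of_mulEquiv (Subgroup.subgroupOfEquivOfLe h)

theorem TwoMaximalSQuasinormal.isNilpotent_of_ne_top [Finite G]
    (h : TwoMaximalSQuasinormal G) {H : Subgroup G} (hH : H ≠ ⊤) : Group.IsNilpotent H := by
  obtain ⟨M, hM, hle⟩ := (eq_top_or_exists_le_coatom H).resolve_left hH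
  have := h.isNilpotent_of_isCoatom hM
  exact isNilpotent_of_le hle

theorem TwoMaximalSQuasinormal.quotient [Finite G] (h : TwoMaximalSQuasinormal G)
    (N : Subgroup G) [N.Normal] : TwoMaximalSQuasinormal (G ⧸ N) := by
  intro M hM A hA
  have hs := QuotientGroup.mk'_surjective N
  have hs' : Function.Surjective ((QuotientGroup.mk' N).subgroupComap M) :=
    (QuotientGroup.mk' N).subgroupComap_surjective_of_surjective M hs
  have := (h _ (Subgroup.isCoatom_comap_of_surjective hs hM) _
    (Subgroup.isCoatom_comap_of_surjective hs' hA)).map hs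
  rw [Subgroup.map_map] at this
  convert this using 1
  rw [show (QuotientGroup.mk' N).comp (M.comap (QuotientGroup.mk' N)).subtype =
    M.subtype.comp ((QuotientGroup.mk' N).subgroupComap M) from rfl, ← Subgroup.map_map,
    Subgroup.map_comap_eq_self_of_surjective hs']

theorem commute_of_coprime_prime_pow [Finite G] [Group.IsNilpotent G] {p q k l : ℕ}
    (hp : p.Prime) (hq : q.Prime) (hpq : p ≠ q) {a b : G} (ha : a ^ p ^ k = 1)
    (hb : b ^ q ^ l = 1) : Commute a b := by
  have := Fact.mk hp
  have := Fact.mk hq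
  obtain ⟨P, hP⟩ := exists_sylow_mem ha
  obtain ⟨Q, hQ⟩ := exists_sylow_mem hb
  exact Subgroup.commute_of_normal_of_disjoint P Q inferInstance inferInstance
    (IsPGroup.disjoint_of_ne p q hpq _ _ P.isPGroup' Q.isPGroup') a b hP hQ

theorem isSolvable_of_pResidual_ne_top [Finite G] [IsSimpleGroup G] {p : ℕ} (hp : p.Prime)
    (h : pResidual p G ≠ ⊤) : Group.IsSolvable G := by
  have := Fact.mk hp
  have hbot := (Subgroup.Normal.eq_bot_or_eq_top (pResidual_normal (G := G) p)).resolve_right h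
  have hG : IsPGroup p G := by
    intro g
    obtain ⟨k, hk⟩ := isPGroup_quotient_pResidual (p := p) (g : G ⧸ pResidual p G)
    refine ⟨k, ?_⟩
    rwa [← QuotientGroup.mk_pow, QuotientGroup.eq_one_iff, hbot, Subgroup.mem_bot] at hk
  have := hG.isNilpotent
  infer_instance

theorem isSolvable_of_isSQuasinormal [Finite G] [IsSimpleGroup G] {B : Subgroup G}
    (hB : IsSQuasinormal B) (hbot : B ≠ ⊥) (htop : B ≠ ⊤)
    (hnil : ∀ H : Subgroup G, H ≠ ⊤ → Group.IsNilpotent H) : Group.IsSolvable G := by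
  by_cases hex : ∃ p : ℕ, p.Prime ∧ ∃ P : Sylow p G, B ⊔ P = ⊤
  · obtain ⟨p, hp, P, hP⟩ := hex
    refine isSolvable_of_pResidual_ne_top hp fun h => htop ?_
    rw [← top_le_iff, ← h]
    exact hB.pResidual_le hp P hP
  push Not at hex
  obtain ⟨r, hr, hdvd⟩ := Nat.exists_prime_and_dvd (mt Subgroup.card_eq_one.mp hbot)
  have := Fact.mk hr
  obtain ⟨⟨a, haB⟩, ha⟩ := exists_prime_orderOf_dvd_card' r hdvd
  rw [Subgroup.orderOf_mk] at ha
  by_cases hres : pResidual r G = ⊤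
  swap
  · exact isSolvable_of_pResidual_ne_top hr hres
  have hcent : pResidual r G ≤ Subgroup.centralizer {a} := by
    rw [pResidual, Subgroup.closure_le]
    rintro x ⟨q, hq, hqr, k, hk⟩
    obtain ⟨Q, hQ⟩ := exists_sylow_mem hk
    have := hnil _ (hex q hq Q)
    have hc : Commute (⟨a, Subgroup.mem_sup_left haB⟩ : ↥(B ⊔ (Q : Subgroup G)))
        ⟨x, Subgroup.mem_sup_right hQ⟩ :=
      commute_of_coprime_prime_pow (k := 1) hr hq hqr.symm
        (Subtype.ext (by simp [← ha, pow_orderOf_eq_one])) (Subtype.ext hk)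
    exact Subgroup.mem_centralizer_singleton_iff.mpr (congrArg Subtype.val hc).symm
  rw [hres] at hcent
  have hac : a ∈ Subgroup.center G := Subgroup.mem_center_iff.mpr fun g =>
    Subgroup.mem_centralizer_singleton_iff.mp (hcent (Subgroup.mem_top g))
  have hcenter : Subgroup.center G = ⊤ := by
    refine (Subgroup.Normal.eq_bot_or_eq_top inferInstance).resolve_left fun h => ?_
    rw [h, Subgroup.mem_bot] at hac
    rw [hac, orderOf_one] at ha
    exact hr.ne_one ha.symm
  refine IsSimpleGroup.comm_iff_isSolvable.mp fun x y => ?_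
  have hy : y ∈ Subgroup.center G := hcenter ▸ Subgroup.mem_top y
  exact Subgroup.mem_center_iff.mp hy x

theorem isCyclic_of_isCoatom_imp_bot [Finite G] (h : ∀ A : Subgroup G, IsCoatom A → A = ⊥) :
    IsCyclic G := by
  by_cases hG : Nontrivial G
  · obtain ⟨x, hx⟩ := exists_ne (1 : G)
    rcases eq_top_or_exists_le_coatom (Subgroup.zpowers x) with htop | ⟨A, hA, hle⟩
    · exact ⟨x, Subgroup.eq_top_iff' _ |>.mp htop⟩
    · rw [h A hA, le_bot_iff, Subgroup.zpowers_eq_bot] at hle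
      exact absurd hle hx
  · rw [not_nontrivial_iff_subsingleton] at hG
    infer_instance

theorem TwoMaximalSQuasinormal.isSolvable_of_isSimpleGroup [Finite G] [IsSimpleGroup G]
    (h : TwoMaximalSQuasinormal G) : Group.IsSolvable G := by
  by_cases hex : ∃ M : Subgroup G, IsCoatom M ∧ ∃ A : Subgroup M, IsCoatom A ∧ A ≠ ⊥
  · obtain ⟨M, hM, A, hA, hbot⟩ := hex
    refine isSolvable_of_isSQuasinormal (h M hM A hA) ?_ ?_ fun _ => h.isNilpotent_of_ne_top
    · rwa [Ne, Subgroup.map_eq_bot_iff_of_injective _ M.subtype_injective]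
    · exact fun htop => hM.1 (top_le_iff.mp (htop ▸ Subgroup.map_subtype_le A))
  push Not at hex
  by_cases hnil : Group.IsNilpotent G
  · infer_instance
  have hZ : IsZGroup G := by
    refine ⟨fun p hp P => ?_⟩
    have := Fact.mk hp
    have hP : (P : Subgroup G) ≠ ⊤ := by
      intro htop
      have hN := P.isPGroup'.isNilpotent
      rw [htop, Group.isNilpotent_top] at hN
      exact hnil hN
    obtain ⟨M, hM, hle⟩ := (eq_top_or_exists_le_coatom _).resolve_left hP
    have := isCyclic_of_isCoatom_imp_bot (hex M hM)
    exact Subgroup.isCyclic_of_le hle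
  infer_instance

theorem TwoMaximalSQuasinormal.exists_normal_index_prime [Finite G] [Nontrivial G]
    (h : TwoMaximalSQuasinormal G) : ∃ N : Subgroup G, N.Normal ∧ N.index.Prime := by
  induction hn : Nat.card G using Nat.strong_induction_on generalizing G with
  | _ n ih =>
  by_cases hs : IsSimpleGroup G
  · have := h.isSolvable_of_isSimpleGroup
    have hc : IsMulCommutative G := ⟨⟨IsSimpleGroup.comm_iff_isSolvable.mpr this⟩⟩
    refine ⟨⊥, inferInstance, ?_⟩
    rw [Subgroup.index_bot]
    exact Group.is_simple_iff_prime_card.mp hs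
  · obtain ⟨N, hN, hbot, htop⟩ : ∃ N : Subgroup G, N.Normal ∧ N ≠ ⊥ ∧ N ≠ ⊤ := by
      by_contra! hall
      exact hs ⟨fun N hN => or_iff_not_imp_left.mpr (hall N hN)⟩
    have : Nontrivial (G ⧸ N) := QuotientGroup.nontrivial_iff.mpr htop
    have hlt : Nat.card (G ⧸ N) < n := by
      rw [← hn, Subgroup.card_eq_card_quotient_mul_card_subgroup N]
      exact lt_mul_of_one_lt_right Nat.card_pos (Subgroup.one_lt_card_iff_ne_bot N |>.mpr hbot)
    obtain ⟨K, hK, hp⟩ := ih _ hlt (h.quotient N) rfl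
    refine ⟨K.comap (QuotientGroup.mk' N), inferInstance, ?_⟩
    rwa [Subgroup.index_comap_of_surjective _ (QuotientGroup.mk'_surjective N)]

theorem isCyclic_map_mk_iff {H K : Subgroup G} [K.Normal] :
    IsCyclic (H.map (QuotientGroup.mk' K)) ↔ ∃ g ∈ H, ∀ x ∈ H, ∃ n : ℤ, (g ^ n)⁻¹ * x ∈ K := by
  constructor
  · rintro ⟨⟨_, g, hg, rfl⟩, hgen⟩
    refine ⟨g, hg, fun x hx => ?_⟩
    obtain ⟨n, hn⟩ := hgen ⟨_, Subgroup.mem_map_of_mem (QuotientGroup.mk' K) hx⟩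
    refine ⟨n, QuotientGroup.eq.mp ?_⟩
    simpa using congrArg Subtype.val hn
  · rintro ⟨g, hg, hgen⟩
    refine ⟨⟨_, Subgroup.mem_map_of_mem (QuotientGroup.mk' K) hg⟩, ?_⟩
    rintro ⟨_, x, hx, rfl⟩
    obtain ⟨n, hn⟩ := hgen x hx
    refine ⟨n, Subtype.ext ?_⟩
    simpa using QuotientGroup.eq.mpr hn

theorem IsSupersoluble.of_isCyclic_quotient {N : Subgroup G} [N.Normal] [IsCyclic N]
    (h : IsSupersoluble (G ⧸ N)) : IsSupersoluble G := by
  obtain ⟨n, s, hnorm, h0, hlast, hs⟩ := h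
  let t : Fin (n + 2) → Subgroup G :=
    Fin.cons ⊥ fun i => (s i).comap (QuotientGroup.mk' N)
  have ht0 : t 0 = ⊥ := rfl
  have htsucc (i : Fin (n + 1)) : t i.succ = (s i).comap (QuotientGroup.mk' N) := rfl
  have htnorm (i) : (t i).Normal := by
    refine Fin.cases ?_ (fun j => ?_) i
    · rw [ht0]
      infer_instance
    · rw [htsucc]
      infer_instance
  refine ⟨n + 1, t, htnorm, ht0, ?_, fun i => ?_⟩
  · rw [← Fin.succ_last, htsucc, hlast, Subgroup.comap_top]
  refine Fin.cases ⟨bot_le, isCyclic_map_mk_iff.mpr ?_⟩ (fun j => ⟨?_, isCyclic_map_mk_iff.mpr ?_⟩) i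
  · obtain ⟨⟨g, hg⟩, hgen⟩ := IsCyclic.exists_generator (α := N)
    have h1 : t (Fin.succ 0) = N := by
      rw [htsucc, h0, MonoidHom.comap_bot, QuotientGroup.ker_mk']
    rw [h1]
    refine ⟨g, hg, fun x hx => ?_⟩
    obtain ⟨k, hk⟩ := hgen ⟨x, hx⟩
    refine ⟨k, ?_⟩
    have : g ^ k = x := congrArg Subtype.val hk
    rw [this, inv_mul_cancel]
    exact one_mem _
  · exact Subgroup.comap_mono (hs j).1
  · obtain ⟨g, hg, hgen⟩ := (@isCyclic_map_mk_iff _ _ _ _ (hnorm j.castSucc)).mp (hs j).2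
    obtain ⟨g, rfl⟩ := QuotientGroup.mk_surjective g
    refine ⟨g, hg, fun x hx => ?_⟩
    exact hgen x hx

theorem zpowers_normal_of_mem_center {x : G} (hx : x ∈ Subgroup.center G) :
    (Subgroup.zpowers x).Normal := by
  refine ⟨fun y hy g => ?_⟩
  have hyc : y ∈ Subgroup.center G := Subgroup.zpowers_le.mpr hx hy
  rwa [Subgroup.mem_center_iff.mp hyc g, mul_inv_cancel_right]

theorem isSupersoluble_of_isNilpotent [Finite G] [Group.IsNilpotent G] : IsSupersoluble G := by
  induction hn : Nat.card G using Nat.strong_induction_on generalizing G with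
  | _ n ih =>
  by_cases hG : Nontrivial G
  · obtain ⟨x, hx, hx1⟩ := (Subgroup.nontrivial_iff_exists_ne_one _).mp
      ((Subgroup.nontrivial_iff_ne_bot _).mpr (Group.IsNilpotent.center_ne_bot (G := G)))
    have hN : (Subgroup.zpowers x).Normal := zpowers_normal_of_mem_center hx
    refine IsSupersoluble.of_isCyclic_quotient (N := Subgroup.zpowers x) (ih _ ?_ rfl)
    rw [← hn, Subgroup.card_eq_card_quotient_mul_card_subgroup (Subgroup.zpowers x)]
    refine lt_mul_of_one_lt_right Nat.card_pos (Subgroup.one_lt_card_iff_ne_bot _ |>.mpr ?_)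
    rwa [Ne, Subgroup.zpowers_eq_bot]
  · rw [not_nontrivial_iff_subsingleton] at hG
    exact ⟨0, fun _ => ⊥, fun _ => inferInstance, rfl, Subsingleton.elim _ _, fun i => i.elim0⟩

theorem le_centralizer_of_isNilpotent {H M : Subgroup G} [hH : H.Normal] [hM : M.Normal]
    [Group.IsNilpotent M] (hmin : ∀ N : Subgroup G, N.Normal → N ≠ ⊥ → N ≤ H → N = H) :
    M ≤ Subgroup.centralizer (H : Set G) := by
  rw [← Subgroup.commutator_eq_bot_iff_le_centralizer]
  by_contra hne
  have hcomm : ⁅M, H⁆ = H := hmin _ inferInstance hne (Subgroup.commutator_le_right M H)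
  have hHM : H ≤ M := hcomm ▸ Subgroup.commutator_le_left M H
  obtain ⟨n, hn⟩ := (Subgroup.isNilpotent_iff_lowerCentralSeries M).mp inferInstance
  have hle (k : ℕ) : H ≤ M.lowerCentralSeries k := by
    induction k with
    | zero => exact hHM
    | succ k ih =>
      rw [Subgroup.lowerCentralSeries_succ, ← hcomm, Subgroup.commutator_comm]
      exact Subgroup.commutator_mono ih le_rfl
  have hbot : H = ⊥ := le_bot_iff.mp (hn ▸ hle n)
  exact hne (by rw [hbot, Subgroup.commutator_bot_right])

theorem index_chiefCentralizer_dvd {M : Subgroup G} [M.Normal] [Group.IsNilpotent M]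
    {H K : Subgroup G} (hc : IsChiefFactor H K) :
    (chiefCentralizer H K hc.1).index ∣ M.index := by
  obtain ⟨hK, hH, hlt, hmin⟩ := hc
  refine Subgroup.index_dvd_of_le ?_
  have hs := QuotientGroup.mk'_surjective K
  have hHn : (H.map (QuotientGroup.mk' K)).Normal := hH.map _ hs
  have hMn : (M.map (QuotientGroup.mk' K)).Normal := Subgroup.Normal.map ‹_› _ hs
  have : Group.IsNilpotent (M.map (QuotientGroup.mk' K)) :=
    Group.nilpotent_of_surjective _ ((QuotientGroup.mk' K).subgroupMap_surjective M)
  rw [chiefCentralizer, ← Subgroup.map_le_iff_le_comap]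
  refine le_centralizer_of_isNilpotent fun N hN hne hle => ?_
  have hcomap : (H.map (QuotientGroup.mk' K)).comap (QuotientGroup.mk' K) = H :=
    Subgroup.comap_map_eq_self (by simpa using hlt.le)
  have hbot : (⊥ : Subgroup (G ⧸ K)).comap (QuotientGroup.mk' K) = K := by
    rw [MonoidHom.comap_bot, QuotientGroup.ker_mk']
  have := hmin (N.comap (QuotientGroup.mk' K)) inferInstance
    (by
      conv_lhs => rw [← hbot]
      exact (Subgroup.comap_lt_comap_of_surjective hs).mpr (bot_lt_iff_ne_bot.mpr hne))
    (by
      conv_rhs => rw [← hcomap]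
      exact Subgroup.comap_mono hle)
  exact (Subgroup.map_comap_eq_self_of_surjective hs N).symm.trans (congrArg _ this)

theorem mem_of_pow_mem_of_coprime {N : Subgroup G} [N.Normal] {x : G} {n : ℕ} (hx : x ^ n ∈ N)
    (hn : n.Coprime N.index) : x ∈ N := by
  rw [← QuotientGroup.eq_one_iff, ← orderOf_eq_one_iff]
  refine Nat.eq_one_of_dvd_coprimes hn (orderOf_dvd_of_pow_eq_one ?_) (orderOf_dvd_natCard _)
  rwa [← QuotientGroup.mk_pow, QuotientGroup.eq_one_iff]

theorem mem_of_orderOf_coprime {N : Subgroup G} [N.Normal] {x : G}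
    (hx : (orderOf x).Coprime N.index) : x ∈ N :=
  mem_of_pow_mem_of_coprime (n := orderOf x) (by rw [pow_orderOf_eq_one]; exact one_mem N) hx

theorem commute_of_orderOf_coprime [Finite G] [Group.IsNilpotent G] {q k : ℕ} (hq : q.Prime)
    {x y : G} (hx : (orderOf x).Coprime q) (hy : y ^ q ^ k = 1) : Commute x y := by
  have := Fact.mk hq
  obtain ⟨n, hn⟩ := (isPGroup_quotient_pResidual (G := G) (p := q)).exists_card_eq
  have hmem : x ∈ pResidual q G := by
    refine mem_of_orderOf_coprime ?_
    rw [Subgroup.index, hn]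
    exact hx.pow_right n
  have hle : pResidual q G ≤ Subgroup.centralizer {y} := by
    rw [pResidual, Subgroup.closure_le]
    rintro z ⟨r, hr, hrq, l, hl⟩
    exact Subgroup.mem_centralizer_singleton_iff.mpr
      (commute_of_coprime_prime_pow hr hq hrq hl hy)
  exact Subgroup.mem_centralizer_singleton_iff.mp (hle hmem)

theorem isCoatom_of_index_prime {M : Subgroup G} (hM : M.index.Prime) : IsCoatom M := by
  refine ⟨fun h => hM.ne_one (Subgroup.index_eq_one.mpr h), fun K hK => ?_⟩
  have hmul := Subgroup.relIndex_mul_index hK.le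
  rcases (Nat.dvd_prime hM).mp (Dvd.intro_left _ hmul) with h | h
  · exact Subgroup.index_eq_one.mp h
  · rw [h] at hmul
    exact absurd (Subgroup.relIndex_eq_one.mp ((Nat.mul_eq_right hM.ne_zero).mp hmul)) hK.not_ge

theorem isNilpotent_of_normal_sylow [Finite G] {M : Subgroup G} [M.Normal] [Group.IsNilpotent M]
    (hM : M.index.Prime) (Q : Sylow M.index G) [hQ : (Q : Subgroup G).Normal] :
    Group.IsNilpotent G := by
  refine (Group.isNilpotent_of_finite_tfae (G := G)).out 0 3 rfl rfl |>.mpr fun p hp P => ?_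
  by_cases hpq : p = M.index
  · subst hpq
    have := Sylow.unique_of_normal Q hQ
    rwa [Subsingleton.elim P Q]
  · have hPM : (P : Subgroup G) ≤ M := by
      intro x hx
      obtain ⟨k, hk⟩ := P.isPGroup' ⟨x, hx⟩
      have hk' : x ^ p ^ k = 1 := congrArg Subtype.val hk
      refine mem_of_pow_mem_of_coprime (n := p ^ k) (by rw [hk']; exact one_mem M) ?_
      exact ((Nat.coprime_primes hp.out hM).mpr hpq).pow_left k
    have hchar : ((P.subtype hPM : Sylow p M) : Subgroup M).Characteristic :=
      Sylow.characteristic_of_normal _ inferInstance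
    have hn := ConjAct.normal_of_characteristic_of_normal (K := (P.subtype hPM : Subgroup M))
    rwa [Sylow.coe_subtype, Subgroup.map_subgroupOf_eq_of_le hPM] at hn

theorem TwoMaximalSQuasinormal.map_le_normalizer_sylow [Finite G] (h : TwoMaximalSQuasinormal G)
    {M : Subgroup G} (hM : IsCoatom M) {q : ℕ} (hq : q.Prime) (Q : Sylow q G) {A : Subgroup M}
    (hA : IsCoatom A) (hQA : (Q : Subgroup G).subgroupOf M ≤ A) :
    A.map M.subtype ≤ Subgroup.normalizer (Q : Set G) := by
  have := Fact.mk hq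
  have hne : A.map M.subtype ⊔ Q ≠ ⊤ := by
    intro htop
    refine hA.1 ((Subgroup.eq_top_iff' A).mpr fun x => ?_)
    obtain ⟨p, hp, _, ⟨a, ha, rfl⟩, hpa⟩ :=
      mem_sup_of_mul_comm (h M hM A hA q hq Q) (htop ▸ Subgroup.mem_top (x : G))
    have hpx : p = ((x * a⁻¹ : M) : G) := by simp [← hpa]
    have hxa : x * a⁻¹ ∈ A := hQA (Subgroup.mem_subgroupOf.mpr (hpx ▸ hp))
    simpa using mul_mem hxa ha
  have := h.isNilpotent_of_ne_top hne
  have hn : ((Q : Subgroup G).subgroupOf (A.map M.subtype ⊔ Q)).Normal := by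
    rw [← Sylow.coe_subtype (h := le_sup_right)]
    infer_instance
  exact le_sup_left.trans ((Subgroup.normal_subgroupOf_iff_le_normalizer le_sup_right).mp hn)

theorem TwoMaximalSQuasinormal.coatom_unique [Finite G] (h : TwoMaximalSQuasinormal G)
    {M : Subgroup G} [M.Normal] (hM : M.index.Prime) (hnil : ¬ Group.IsNilpotent G)
    (Q : Sylow M.index G) {A B : Subgroup M} (hA : IsCoatom A) (hB : IsCoatom B)
    (hQA : (Q : Subgroup G).subgroupOf M ≤ A) (hQB : (Q : Subgroup G).subgroupOf M ≤ B) :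
    A = B := by
  by_contra hne
  have := Fact.mk hM
  have hco := isCoatom_of_index_prime hM
  have := h.isNilpotent_of_isCoatom hco
  have hMN : M ≤ Subgroup.normalizer (Q : Set G) := by
    have hsup : A ⊔ B = ⊤ := hA.2 _ (left_lt_sup.mpr fun hle =>
      hne ((hB.le_iff.mp hle).resolve_left hA.1))
    have := sup_le (h.map_le_normalizer_sylow hco hM Q hA hQA)
      (h.map_le_normalizer_sylow hco hM Q hB hQB)
    rwa [← Subgroup.map_sup, hsup, ← MonoidHom.range_eq_map, Subgroup.range_subtype] at this
  have hQM : ¬ (Q : Subgroup G) ≤ M := fun hle =>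
    Q.not_dvd_index (Subgroup.index_dvd_of_le hle)
  have hsup : M ⊔ Q = ⊤ := hco.2 _ (left_lt_sup.mpr hQM)
  have hnorm : (Q : Subgroup G).Normal := by
    rw [← Subgroup.normalizer_eq_top_iff, ← top_le_iff, ← hsup]
    exact sup_le hMN Subgroup.le_normalizer
  exact hnil (isNilpotent_of_normal_sylow hM Q)

theorem not_dvd_index_sylow_subgroupOf [Finite G] {M : Subgroup G} [M.Normal] {q : ℕ}
    (hq : q.Prime) (Q : Sylow q G) : ¬ q ∣ ((Q : Subgroup G).subgroupOf M).index := by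
  have := Fact.mk hq
  intro hdvd
  change q ∣ (Q : Subgroup G).relIndex M at hdvd
  rw [← relIndex_sup_of_mul_comm (Subgroup.set_mul_normal_comm _ M)] at hdvd
  exact Q.not_dvd_index (hdvd.trans (Subgroup.relIndex_dvd_index_of_le le_sup_left))

theorem exists_orderOf_coprime_not_mem [Finite G] [Group.IsNilpotent G] {q : ℕ} (hq : q.Prime)
    {S : Subgroup G} (hS : ¬ q ∣ S.index)
    (huniq : ∀ A B : Subgroup G, IsCoatom A → IsCoatom B → S ≤ A → S ≤ B → A = B) :
    ∃ x : G, (orderOf x).Coprime q ∧ Subgroup.zpowers x ⊔ S = ⊤ := by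
  suffices ∃ x : G, (orderOf x).Coprime q ∧ ∀ A : Subgroup G, IsCoatom A → S ≤ A → x ∉ A by
    obtain ⟨x, hx, hA⟩ := this
    refine ⟨x, hx, (eq_top_or_exists_le_coatom _).resolve_right ?_⟩
    rintro ⟨A, hco, hle⟩
    rw [sup_le_iff, Subgroup.zpowers_le] at hle
    exact hA A hco hle.2 hle.1
  by_cases hex : ∃ A : Subgroup G, IsCoatom A ∧ S ≤ A
  swap
  · exact ⟨1, by simp, fun A hA hSA => absurd ⟨A, hA, hSA⟩ hex⟩
  obtain ⟨A, hA, hSA⟩ := hex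
  obtain ⟨x, hx⟩ : ∃ x, x ∉ A := by
    by_contra! hall
    exact hA.1 ((Subgroup.eq_top_iff' A).mpr hall)
  obtain ⟨k, m, hm, hkm⟩ :=
    Nat.exists_eq_pow_mul_and_not_dvd (orderOf_pos x).ne' q hq.ne_one
  refine ⟨x ^ q ^ k, ?_, fun B hB hSB hxB => ?_⟩
  · refine Nat.Coprime.coprime_dvd_left (k := m) (orderOf_dvd_of_pow_eq_one ?_)
      ((Nat.Prime.coprime_iff_not_dvd hq).mpr hm).symm
    rw [← pow_mul, ← hkm, pow_orderOf_eq_one]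
  · rw [huniq B A hB hA hSB hSA] at hxB
    have := normal_of_isCoatom hA
    refine hx (mem_of_pow_mem_of_coprime hxB (Nat.Coprime.pow_left k ?_))
    exact (Nat.Prime.coprime_iff_not_dvd hq).mpr fun hdvd =>
      hS (hdvd.trans (Subgroup.index_dvd_of_le hSA))

theorem TwoMaximalSQuasinormal.isSupersoluble_of_not_isNilpotent [Finite G]
    (h : TwoMaximalSQuasinormal G) {M : Subgroup G} [M.Normal] (hM : M.index.Prime)
    (hnil : ¬ Group.IsNilpotent G) : IsSupersoluble G := by
  have := Fact.mk hM
  have := h.isNilpotent_of_isCoatom (isCoatom_of_index_prime hM)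
  let Q : Sylow M.index G := default
  obtain ⟨x, hx, hsup⟩ := exists_orderOf_coprime_not_mem hM
    (not_dvd_index_sylow_subgroupOf (M := M) hM Q)
    fun A B hA hB hQA hQB => h.coatom_unique hM hnil Q hA hB hQA hQB
  have hQp : IsPGroup M.index ((Q : Subgroup G).subgroupOf M) :=
    Q.isPGroup'.comap_of_injective M.subtype M.subtype_injective
  have hcenter : x ∈ Subgroup.center M := by
    have hle : Subgroup.zpowers x ⊔ (Q : Subgroup G).subgroupOf M ≤ Subgroup.centralizer {x} := by
      refine sup_le (Subgroup.zpowers_le.mpr (Subgroup.mem_centralizer_singleton_iff.mpr rfl)) ?_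
      intro y hy
      obtain ⟨k, hk⟩ := hQp ⟨y, hy⟩
      exact Subgroup.mem_centralizer_singleton_iff.mpr
        (commute_of_orderOf_coprime hM hx (congrArg Subtype.val hk)).symm
    exact Subgroup.mem_center_iff.mpr fun g =>
      Subgroup.mem_centralizer_singleton_iff.mp (hle (hsup ▸ Subgroup.mem_top g))
  have hxn := zpowers_normal_of_mem_center hcenter
  obtain ⟨n, hn⟩ : ∃ n, (Subgroup.zpowers x).index = M.index ^ n := by
    obtain ⟨n, hn⟩ := hQp.exists_card_eq
    have hdvd := Subgroup.relIndex_dvd_card (Subgroup.zpowers x) ((Q : Subgroup G).subgroupOf M)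
    rw [← relIndex_sup_of_mul_comm (Subgroup.set_mul_normal_comm _ _).symm, hsup,
      Subgroup.relIndex_top_right, hn] at hdvd
    obtain ⟨m, -, hm⟩ := (Nat.dvd_prime_pow hM).mp hdvd
    exact ⟨m, hm⟩
  have hmap : (Subgroup.zpowers x).map M.subtype = Subgroup.zpowers (x : G) :=
    MonoidHom.map_zpowers M.subtype x
  have hN : (Subgroup.zpowers (x : G)).Normal := by
    refine ⟨fun y hy g => ?_⟩
    have hyM : y ∈ M := Subgroup.zpowers_le.mpr x.2 hy
    have hyo : orderOf y ∣ orderOf x := by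
      rw [← Subgroup.orderOf_coe]
      exact orderOf_dvd_of_mem_zpowers hy
    rw [← hmap]
    refine ⟨⟨g * y * g⁻¹, Subgroup.Normal.conj_mem inferInstance y hyM g⟩, ?_, rfl⟩
    refine mem_of_orderOf_coprime ?_
    rw [Subgroup.orderOf_mk, hn]
    refine Nat.Coprime.pow_right n (hx.coprime_dvd_left ?_)
    refine orderOf_dvd_of_pow_eq_one ?_
    rw [conj_pow, orderOf_dvd_iff_pow_eq_one.mp hyo, mul_one, mul_inv_cancel]
  have hGN : IsPGroup M.index (G ⧸ Subgroup.zpowers (x : G)) := by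
    refine IsPGroup.of_card (n := n + 1) ?_
    change (Subgroup.zpowers (x : G)).index = _
    rw [← hmap, Subgroup.index_map_subtype, hn, pow_succ]
  have := hGN.isNilpotent
  exact IsSupersoluble.of_isCyclic_quotient (N := Subgroup.zpowers (x : G))
    isSupersoluble_of_isNilpotent

theorem IsCoatom.isMaximalIn {M : Subgroup G} {A : Subgroup M} (hA : IsCoatom A) :
    IsMaximalIn M (A.map M.subtype) := by
  refine ⟨lt_of_le_of_ne (Subgroup.map_subtype_le A) fun h => hA.1 ?_, fun L hL hLM => ?_⟩
  · refine Subgroup.map_injective M.subtype_injective ?_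
    rw [h, ← MonoidHom.range_eq_map, Subgroup.range_subtype]
  · have hLmap : (L.subgroupOf M).map M.subtype = L := Subgroup.map_subgroupOf_eq_of_le hLM
    rw [← hLmap, Subgroup.map_lt_map_iff_of_injective M.subtype_injective] at hL
    rw [← hLmap, hA.2 _ hL, ← MonoidHom.range_eq_map, Subgroup.range_subtype]

theorem isNMaximal_two {M : Subgroup G} (hM : IsCoatom M) {A : Subgroup M} (hA : IsCoatom A) :
    IsNMaximal 2 (A.map M.subtype) := by
  refine ⟨![⊤, M, A.map M.subtype], rfl, rfl, fun i => ?_⟩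
  fin_cases i
  · exact ⟨hM.lt_top, fun L hL _ => hM.2 L hL⟩
  · exact hA.isMaximalIn

/-- Corollary 4.2: if every 2-maximal subgroup of the finite group `G` is
S-quasinormal in `G`, then `G` is nearly nilpotent. -/
theorem nearlyNilpotent_of_twoMaximal_squasinormal
    {G : Type*} [Group G] [Finite G]
    (h : ∀ M : Subgroup G, IsNMaximal 2 M → IsSQuasinormal M) :
    IsNearlyNilpotent G := by
  have h2 : TwoMaximalSQuasinormal G := fun M hM A hA => h _ (isNMaximal_two hM hA)
  by_cases hnil : Group.IsNilpotent G
  · refine ⟨isSupersoluble_of_isNilpotent, fun H K hc _ => ⟨2, Nat.prime_two, ?_⟩⟩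
    have : Group.IsNilpotent (⊤ : Subgroup G) := Group.isNilpotent_top.mpr hnil
    have hdvd := index_chiefCentralizer_dvd (M := ⊤) hc
    rw [Subgroup.index_top] at hdvd
    exact hdvd.trans (one_dvd 2)
  · have : Nontrivial G := by
      by_contra hG
      rw [not_nontrivial_iff_subsingleton] at hG
      exact hnil inferInstance
    obtain ⟨M, hMn, hM⟩ := h2.exists_normal_index_prime
    have := h2.isNilpotent_of_isCoatom (isCoatom_of_index_prime hM)
    exact ⟨h2.isSupersoluble_of_not_isNilpotent hM hnil,
      fun H K hc _ => ⟨M.index, hM, index_chiefCentralizer_dvd hc⟩⟩
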